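/- Let n ≥ 2, let x be a random vector in ℝⁿ with multivariate Gaussian distribution N(m, S) where S is positive definite, fix an index k and censoring limits a < b, and let P = F_{e_k}(b − m_k) − F_{e_k}(a − m_k). Then for every index i ≠ k, Cov(x_i, clip_{a,b}(x_k)) = P·S_{i,k}. -/

import Mathlib

open MeasureTheory ProbabilityTheory Real

/-- The standard normal cumulative distribution function Φ. -/
noncomputable def stdNormalCDF (x : ℝ) : ℝ :=
  ((gaussianReal 0 1) (Set.Iic x)).toReal

/-- The standard normal probability density function φ. -/
noncomputable def stdNormalPDF (x : ℝ) : ℝ :=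
  gaussianPDFReal 0 1 x

/-- The censoring (clipping) map: `clip a b x = x` if `a < x < b`,
`= a` if `x ≤ a`, `= b` if `x ≥ b` (for `a < b`). -/
noncomputable def clip (a b x : ℝ) : ℝ := max a (min b x)
/-- A random vector `X` has the multivariate Gaussian distribution `N(m, S)` iff every
linear combination `∑ i, t i * X i` is Gaussian with mean `tᵀm` and variance `tᵀSt`. -/
def IsGaussianVector {Ω : Type*} [MeasureSpace Ω] {ι : Type*} [Fintype ι]
    (X : Ω → ι → ℝ) (m : ι → ℝ) (S : Matrix ι ι ℝ) : Prop :=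
  ∀ t : ι → ℝ,
    Measure.map (fun ω => ∑ i, t i * X ω i) ℙ =
      gaussianReal (∑ i, t i * m i) ((∑ i, ∑ j, t i * S i j * t j).toNNReal)

/-- The covariance of two real random variables: Cov(Y, Z) = E[YZ] − E[Y]E[Z]. -/
noncomputable def cov {Ω : Type*} [MeasureSpace Ω] (Y Z : Ω → ℝ) : ℝ :=
  (∫ ω, Y ω * Z ω ∂ℙ) - (∫ ω, Y ω ∂ℙ) * (∫ ω, Z ω ∂ℙ)

lemma clip_eq_left {a b x : ℝ} (hab : a < b) (hx : x ≤ a) : clip a b x = a := by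
  rw [clip, min_eq_right (hx.trans hab.le), max_eq_left hx]

lemma clip_eq_self {a b x : ℝ} (ha : a ≤ x) (hb : x ≤ b) : clip a b x = x := by
  rw [clip, min_eq_right hb, max_eq_right ha]

lemma clip_eq_right {a b x : ℝ} (hab : a < b) (hx : b ≤ x) : clip a b x = b := by
  rw [clip, min_eq_left hx, max_eq_right hab.le]

@[fun_prop]
lemma continuous_clip (a b : ℝ) : Continuous (clip a b) := by
  unfold clip; fun_prop

lemma norm_clip_le (a b x : ℝ) : ‖clip a b x‖ ≤ |a| + |b| := by
  have ha := abs_le.1 (le_refl |a|)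
  have hb := abs_le.1 (le_refl |b|)
  rw [Real.norm_eq_abs, abs_le, clip]
  refine ⟨le_max_of_le_left (by linarith), max_le (by linarith) ?_⟩
  exact (min_le_left _ _).trans (by linarith)

lemma memLp_clip_comp {Ω : Type*} {mΩ : MeasurableSpace Ω} {P : Measure Ω} [IsFiniteMeasure P]
    {Z : Ω → ℝ} (hZ : AEMeasurable Z P) (a b : ℝ) (p : ENNReal) :
    MemLp (fun ω ↦ clip a b (Z ω)) p P :=
  MemLp.of_bound ((continuous_clip a b).measurable.comp_aemeasurable hZ).aestronglyMeasurable
    (|a| + |b|) (.of_forall fun _ ↦ norm_clip_le a b _)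

lemma hasDerivAt_gaussianPDFReal (μ : ℝ) {v : NNReal} (hv : v ≠ 0) (x : ℝ) :
    HasDerivAt (gaussianPDFReal μ v) (-((x - μ) * gaussianPDFReal μ v x) / v) x := by
  have hv' : (v : ℝ) ≠ 0 := by exact_mod_cast hv
  rw [gaussianPDFReal_def]
  have h := (((((hasDerivAt_id x).sub_const μ).pow 2).neg.div_const (2 * (v : ℝ))).exp).const_mul
    (√(2 * π * v))⁻¹
  convert! h using 1
  simp only [id]
  field_simp
  simp [neg_div]
  ring

lemma integrable_sub_mul_gaussianPDFReal (μ : ℝ) {v : NNReal} (hv : v ≠ 0) :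
    Integrable (fun x ↦ (x - μ) * gaussianPDFReal μ v x) := by
  have h : Integrable (fun x ↦ x - μ) (gaussianReal μ v) :=
    (memLp_one_iff_integrable.1 (memLp_id_gaussianReal (μ := μ) (v := v) 1)).sub
      (integrable_const μ)
  rw [gaussianReal_of_var_ne_zero _ hv, integrable_withDensity_iff_integrable_smul'
    (measurable_gaussianPDF μ v) (.of_forall fun _ ↦ gaussianPDF_lt_top)] at h
  simpa [mul_comm] using h

lemma hasDerivAt_neg_mul_gaussianPDFReal (μ : ℝ) {v : NNReal} (hv : v ≠ 0) (x : ℝ) :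
    HasDerivAt (fun x ↦ -v * gaussianPDFReal μ v x) ((x - μ) * gaussianPDFReal μ v x) x := by
  have hv' : (v : ℝ) ≠ 0 := by exact_mod_cast hv
  convert! (hasDerivAt_gaussianPDFReal μ hv x).const_mul (-v : ℝ) using 1
  field_simp

lemma integral_Ioi_sub_mul_gaussianPDFReal (μ : ℝ) {v : NNReal} (hv : v ≠ 0) (t : ℝ) :
    ∫ x in Set.Ioi t, (x - μ) * gaussianPDFReal μ v x = v * gaussianPDFReal μ v t := by
  have hd := hasDerivAt_neg_mul_gaussianPDFReal μ hv
  have hi := (integrable_sub_mul_gaussianPDFReal μ hv).integrableOn (s := Set.Ioi t)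
  rw [integral_Ioi_of_hasDerivAt_of_tendsto' (fun x _ ↦ hd x) hi
    (tendsto_zero_of_hasDerivAt_of_integrableOn_Ioi (fun x _ ↦ hd x) hi
      ((integrable_gaussianPDFReal μ v).const_mul _).integrableOn)]
  ring

lemma integral_Iic_sub_mul_gaussianPDFReal (μ : ℝ) {v : NNReal} (hv : v ≠ 0) (t : ℝ) :
    ∫ x in Set.Iic t, (x - μ) * gaussianPDFReal μ v x = -(v * gaussianPDFReal μ v t) := by
  have hd := hasDerivAt_neg_mul_gaussianPDFReal μ hv
  have hi := (integrable_sub_mul_gaussianPDFReal μ hv).integrableOn (s := Set.Iic t)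
  rw [integral_Iic_of_hasDerivAt_of_tendsto' (fun x _ ↦ hd x) hi
    (tendsto_zero_of_hasDerivAt_of_integrableOn_Iic (fun x _ ↦ hd x) hi
      ((integrable_gaussianPDFReal μ v).const_mul _).integrableOn)]
  ring

lemma continuous_gaussianPDFReal (μ : ℝ) (v : NNReal) : Continuous (gaussianPDFReal μ v) := by
  rw [gaussianPDFReal_def]; fun_prop

lemma intervalIntegral_mul_sub_mul_gaussianPDFReal (μ : ℝ) {v : NNReal} (hv : v ≠ 0) (a b : ℝ) :
    ∫ x in a..b, x * ((x - μ) * gaussianPDFReal μ v x) =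
      v * (∫ x in a..b, gaussianPDFReal μ v x) -
        v * (b * gaussianPDFReal μ v b - a * gaussianPDFReal μ v a) := by
  have hc := continuous_gaussianPDFReal μ v
  rw [intervalIntegral.integral_mul_deriv_eq_deriv_mul (u' := fun _ ↦ 1)
    (fun x _ ↦ hasDerivAt_id' x) (fun x _ ↦ hasDerivAt_neg_mul_gaussianPDFReal μ hv x)
    intervalIntegrable_const (Continuous.intervalIntegrable (by fun_prop) a b)]
  simp only [one_mul, intervalIntegral.integral_const_mul]
  ring

lemma intervalIntegral_gaussianPDFReal (μ : ℝ) {v : NNReal} (hv : v ≠ 0) (a b : ℝ) :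
    ∫ x in a..b, gaussianPDFReal μ v x =
      (gaussianReal μ v).real (Set.Iic b) - (gaussianReal μ v).real (Set.Iic a) := by
  have h (t : ℝ) : (gaussianReal μ v).real (Set.Iic t) =
      ∫ x in Set.Iic t, gaussianPDFReal μ v x := by
    rw [measureReal_def, gaussianReal_apply_eq_integral μ hv, ENNReal.toReal_ofReal
      (integral_nonneg fun x ↦ gaussianPDFReal_nonneg μ v x)]
  rw [h, h, intervalIntegral.integral_Iic_sub_Iic
    (integrable_gaussianPDFReal μ v).integrableOn (integrable_gaussianPDFReal μ v).integrableOn]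

/-- Stein's identity for the clipping map. -/
lemma covariance_id_clip_gaussianReal (μ : ℝ) {v : NNReal} (hv : v ≠ 0) {a b : ℝ} (hab : a < b) :
    cov[id, clip a b; gaussianReal μ v] =
      v * ((gaussianReal μ v).real (Set.Iic b) - (gaussianReal μ v).real (Set.Iic a)) := by
  have hG := integrable_sub_mul_gaussianPDFReal μ hv
  have hcG : Integrable (fun x ↦ clip a b x * ((x - μ) * gaussianPDFReal μ v x)) :=
    hG.bdd_mul (continuous_clip a b).aestronglyMeasurable (.of_forall (norm_clip_le a b))
  have hid : MemLp id 2 (gaussianReal μ v) := memLp_id_gaussianReal 2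
  have hclip : MemLp (clip a b) 2 (gaussianReal μ v) := memLp_clip_comp aemeasurable_id a b 2
  have hsplit : ∫ x, clip a b x * ((x - μ) * gaussianPDFReal μ v x) =
      a * -(v * gaussianPDFReal μ v a) + (∫ x in a..b, x * ((x - μ) * gaussianPDFReal μ v x)) +
        b * (v * gaussianPDFReal μ v b) := by
    rw [← intervalIntegral.integral_Iic_add_Ioi (b := b) hcG.integrableOn hcG.integrableOn,
      ← sub_add_cancel (∫ x in Set.Iic b, _) (∫ x in Set.Iic a, _),
      intervalIntegral.integral_Iic_sub_Iic hcG.integrableOn hcG.integrableOn,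
      add_comm (∫ x in a..b, _),
      setIntegral_congr_fun (g := fun x ↦ a * ((x - μ) * gaussianPDFReal μ v x))
        measurableSet_Iic (fun x hx ↦ by simp only [clip_eq_left hab hx]),
      setIntegral_congr_fun (g := fun x ↦ b * ((x - μ) * gaussianPDFReal μ v x))
        measurableSet_Ioi (fun x hx ↦ by simp only [clip_eq_right hab (le_of_lt hx)]),
      integral_const_mul, integral_const_mul, integral_Iic_sub_mul_gaussianPDFReal μ hv,
      integral_Ioi_sub_mul_gaussianPDFReal μ hv]
    congr 2
    refine intervalIntegral.integral_congr fun x hx ↦ ?_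
    rw [Set.uIcc_of_le hab.le] at hx
    simp only [clip_eq_self hx.1 hx.2]
  calc cov[id, clip a b; gaussianReal μ v]
      = cov[fun x ↦ id x - μ, clip a b; gaussianReal μ v] := by
        rw [covariance_sub_const_left (hid.integrable (by norm_num))]
    _ = ∫ x, (x - μ) * clip a b x ∂gaussianReal μ v := by
        have hmean : ∫ x, (id x - μ) ∂gaussianReal μ v = 0 := by
          rw [integral_sub (hid.integrable (by norm_num)) (integrable_const μ)]
          simp
        rw [covariance_eq_sub (X := fun x ↦ id x - μ) (hid.sub (memLp_const μ)) hclip, hmean]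
        simp
    _ = ∫ x, clip a b x * ((x - μ) * gaussianPDFReal μ v x) := by
        rw [integral_gaussianReal_eq_integral_smul hv]
        congr with x
        rw [smul_eq_mul]; ring
    _ = _ := by
        rw [hsplit, intervalIntegral_mul_sub_mul_gaussianPDFReal μ hv,
          intervalIntegral_gaussianPDFReal μ hv]
        ring

lemma stdNormalCDF_sub_div_sqrt (μ : ℝ) {s : ℝ} (hs : 0 < s) (t : ℝ) :
    stdNormalCDF ((t - μ) / √s) = (gaussianReal μ s.toNNReal).real (Set.Iic t) := by
  have h : gaussianReal μ s.toNNReal = ((gaussianReal 0 1).map (√s * ·)).map (· + μ) := by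
    rw [gaussianReal_map_const_mul, gaussianReal_map_add_const]
    congr 1
    · simp
    · ext; simp [Real.sq_sqrt hs.le, hs.le]
  rw [h, measureReal_def, Measure.map_apply (by fun_prop) measurableSet_Iic,
    Measure.map_apply (by fun_prop) (by measurability), stdNormalCDF]
  congr 2
  ext x
  simp [le_div_iff₀' (Real.sqrt_pos.2 hs), le_sub_iff_add_le]

namespace IsGaussianVector

variable {Ω ι : Type*} [MeasureSpace Ω] [Fintype ι] {X : Ω → ι → ℝ} {m : ι → ℝ}
  {S : Matrix ι ι ℝ}

lemma hasGaussianLaw (hX : IsGaussianVector X m S) (hXm : Measurable X) :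
    HasGaussianLaw X ℙ where
  isGaussian_map := by
    classical
    refine ⟨fun L ↦ ?_⟩
    have hL : (fun ω ↦ ∑ i, L (Pi.single i 1) * X ω i) = L ∘ X := by
      ext ω
      simp only [Function.comp_apply]
      conv_rhs => rw [pi_eq_sum_univ' (X ω), map_sum]
      refine Finset.sum_congr rfl fun i _ ↦ ?_
      rw [map_smul, smul_eq_mul, mul_comm]
    have h := hX fun i ↦ L (Pi.single i 1)
    rw [hL, ← Measure.map_map (by fun_prop) hXm] at h
    have : HasGaussianLaw L (Measure.map X ℙ) := ⟨by rw [h]; infer_instance⟩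
    exact this.map_eq_gaussianReal

lemma variance_sum (hX : IsGaussianVector X m S) (hXm : Measurable X) (hS : S.PosSemidef)
    (t : ι → ℝ) :
    Var[fun ω ↦ ∑ i, t i * X ω i; ℙ] = ∑ i, ∑ j, t i * S i j * t j := by
  have hpos : 0 ≤ ∑ i, ∑ j, t i * S i j * t j := by
    simpa [dotProduct, Matrix.mulVec, Finset.mul_sum, mul_assoc] using
      hS.dotProduct_mulVec_nonneg t
  rw [← variance_id_map (by fun_prop), hX t, variance_id_gaussianReal, Real.coe_toNNReal _ hpos]

lemma variance_eval [DecidableEq ι] (hX : IsGaussianVector X m S) (hXm : Measurable X)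
    (hS : S.PosSemidef) (i : ι) : Var[fun ω ↦ X ω i; ℙ] = S i i := by
  simpa [Pi.single_apply] using hX.variance_sum hXm hS (Pi.single i 1)

lemma map_eval [DecidableEq ι] (hX : IsGaussianVector X m S) (i : ι) :
    Measure.map (fun ω ↦ X ω i) ℙ = gaussianReal (m i) (S i i).toNNReal := by
  simpa [Pi.single_apply] using hX (Pi.single i 1)

lemma covariance_eval [DecidableEq ι] (hX : IsGaussianVector X m S) (hXm : Measurable X)
    (hS : S.PosSemidef) (i j : ι) : cov[fun ω ↦ X ω i, fun ω ↦ X ω j; ℙ] = S i j := by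
  have hG := hX.hasGaussianLaw hXm
  have := hG.isProbabilityMeasure
  have h := hX.variance_sum hXm hS (Pi.single i 1 + Pi.single j 1)
  have hadd := variance_add (hG.eval i).memLp_two (hG.eval j).memLp_two
  have hsymm : S j i = S i j := by simpa using hS.isHermitian.apply i j
  simp only [Pi.add_apply, Pi.single_apply, add_mul, mul_add, Finset.sum_add_distrib, ite_mul,
    mul_ite, one_mul, mul_one, zero_mul, mul_zero, Finset.sum_ite_eq', Finset.mem_univ,
    if_true] at h
  have e : Var[fun ω ↦ X ω i + X ω j; ℙ] = Var[(fun ω ↦ X ω i) + fun ω ↦ X ω j; ℙ] := rfl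
  rw [e, hadd, hX.variance_eval hXm hS, hX.variance_eval hXm hS] at h
  linarith

end IsGaussianVector

/-- The regression residual of `Y` on `Z` is independent of `Z`, so the covariance of `Y` with a
function of `Z` is determined by that of `Z`. -/
lemma ProbabilityTheory.HasGaussianLaw.covariance_comp_right {Ω : Type*} {mΩ : MeasurableSpace Ω}
    {P : Measure Ω} {Y Z : Ω → ℝ} (hYZ : HasGaussianLaw (fun ω ↦ (Y ω, Z ω)) P)
    (hZ : Var[Z; P] ≠ 0) {g : ℝ → ℝ} (hg : Measurable g) (hgZ : MemLp (g ∘ Z) 2 P) :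
    cov[Y, g ∘ Z; P] = cov[Y, Z; P] / Var[Z; P] * cov[Z, g ∘ Z; P] := by
  have := hYZ.isProbabilityMeasure
  set c := cov[Y, Z; P] / Var[Z; P] with hc
  have hY2 := hYZ.fst.memLp_two
  have hZ2 := hYZ.snd.memLp_two
  have hpair : HasGaussianLaw (fun ω ↦ ((Y - c • Z) ω, Z ω)) P :=
    hYZ.map_fun ((ContinuousLinearMap.fst ℝ ℝ ℝ - c • ContinuousLinearMap.snd ℝ ℝ ℝ).prod
      (ContinuousLinearMap.snd ℝ ℝ ℝ))
  have hind : IndepFun (Y - c • Z) Z P := hpair.indepFun_of_covariance_eq_zero <| by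
    rw [covariance_sub_left hY2 (hZ2.const_smul c) hZ2, covariance_smul_left,
      covariance_self hYZ.snd.aemeasurable, hc, div_mul_cancel₀ _ hZ, sub_self]
  have h := (hind.comp measurable_id hg).covariance_eq_zero (hY2.sub (hZ2.const_smul c)) hgZ
  rw [Function.id_comp, covariance_sub_left hY2 (hZ2.const_smul c) hgZ,
    covariance_smul_left] at h
  linarith

theorem cov_uncensored_censored {Ω : Type*} [MeasureSpace Ω]
    [IsProbabilityMeasure (ℙ : Measure Ω)]
    {n : ℕ} (hn : 2 ≤ n)
    (X : Ω → Fin n → ℝ) (hXm : Measurable X)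
    (m : Fin n → ℝ) (S : Matrix (Fin n) (Fin n) ℝ) (hS : S.PosDef)
    (hX : IsGaussianVector X m S)
    (k : Fin n) (a b : ℝ) (hab : a < b)
    (i : Fin n) (hik : i ≠ k) :
    cov (fun ω => X ω i) (fun ω => clip a b (X ω k)) =
      (stdNormalCDF ((b - m k) / Real.sqrt (S k k))
        - stdNormalCDF ((a - m k) / Real.sqrt (S k k))) * S i k := by
  have hG := hX.hasGaussianLaw hXm
  have hk : 0 < S k k := hS.diag_pos
  have hXk : AEMeasurable (fun ω ↦ X ω k) ℙ := by fun_prop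
  have hclip : MemLp (clip a b ∘ fun ω ↦ X ω k) 2 ℙ := memLp_clip_comp hXk a b 2
  have hvar := hX.variance_eval hXm hS.posSemidef k
  have hstein : cov[fun ω ↦ X ω k, clip a b ∘ fun ω ↦ X ω k; ℙ] =
      S k k * (stdNormalCDF ((b - m k) / √(S k k)) - stdNormalCDF ((a - m k) / √(S k k))) := by
    rw [stdNormalCDF_sub_div_sqrt _ hk, stdNormalCDF_sub_div_sqrt _ hk]
    have h := covariance_id_clip_gaussianReal (m k) (v := (S k k).toNNReal) (by simpa using hk) hab
    rw [← hX.map_eval k] at h ⊢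
    rw [covariance_map (by fun_prop) (by fun_prop) hXk] at h
    rw [Real.coe_toNNReal _ hk.le] at h
    exact h
  calc cov (fun ω => X ω i) (fun ω => clip a b (X ω k))
      = cov[fun ω ↦ X ω i, clip a b ∘ fun ω ↦ X ω k; ℙ] :=
        (covariance_eq_sub (hG.eval i).memLp_two hclip).symm
    _ = _ := by
        rw [(hG.prodMk i k).covariance_comp_right (by rw [hvar]; exact hk.ne')
          (continuous_clip a b).measurable hclip, hstein, hvar,
          hX.covariance_eval hXm hS.posSemidef]
        field_simp
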